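/- arXiv:1605.05758 — 4 statements merged into one kernel-verified Lean document; each statement's English description precedes it below -/
import Mathlib

section
/- Suppose the tasks are indexed so that the priority weights are non-increasing, i.e., P_0 ≥ P_1 ≥ ... ≥ P_{n-1}. Then processing the tasks in index order maximizes the total revenue over all schedules: for every permutation σ of {0,...,n-1}, V(id) ≥ V(σ), where id is the identity permutation. -/
open Finset

/-- Completion time of task `i` under schedule `σ` started at time `t0`:
`C_i(σ) = t0 + ∑_{j : σ(j) ≤ σ(i)} d_j`. -/
noncomputable def completionTime (n : ℕ) (d : Fin n → ℝ) (t0 : ℝ)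
    (σ : Equiv.Perm (Fin n)) (i : Fin n) : ℝ :=
  t0 + ∑ j ∈ Finset.univ.filter (fun j => σ j ≤ σ i), d j

/-- Total discounted revenue of schedule `σ`: `V(σ) = ∑_i W_i · α^(C_i(σ) − a_i)`
(real-exponent power). -/
noncomputable def revenue (n : ℕ) (a d W : Fin n → ℝ) (α t0 : ℝ)
    (σ : Equiv.Perm (Fin n)) : ℝ :=
  ∑ i, W i * α ^ (completionTime n d t0 σ i - a i)

/-- Abel summation: an antitone weighting of a sequence with nonnegative partial sums is at
least the total sum scaled by any lower bound of the weights. -/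
theorem mul_sum_le_sum_mul_of_antitoneOn {ι : Type*} [LinearOrder ι] (s : Finset ι)
    (P c : ι → ℝ) (hP : AntitoneOn P s) (hc : ∀ k ∈ s, 0 ≤ ∑ i ∈ s with i ≤ k, c i) (p : ℝ)
    (hp : ∀ i ∈ s, p ≤ P i) : p * ∑ i ∈ s, c i ≤ ∑ i ∈ s, P i * c i := by
  induction s using Finset.induction_on_max generalizing p with
  | empty => simp
  | insert m s hm ih =>
    have hms : m ∉ s := fun h => (hm m h).false
    have htotal : 0 ≤ ∑ i ∈ insert m s, c i := by
      have h := hc m (mem_insert_self m s)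
      rwa [filter_true_of_mem] at h
      intro i hi
      rcases mem_insert.1 hi with rfl | hi
      · exact le_rfl
      · exact (hm i hi).le
    have hs : P m * ∑ i ∈ s, c i ≤ ∑ i ∈ s, P i * c i := by
      refine ih (hP.mono (by simp)) (fun k hk => ?_) _ (fun i hi => ?_)
      · have h := hc k (mem_insert_of_mem hk)
        rwa [filter_insert, if_neg (hm k hk).not_ge] at h
      · exact hP (by simp [hi]) (by simp) (hm i hi).le
    calc p * ∑ i ∈ insert m s, c i ≤ P m * ∑ i ∈ insert m s, c i :=
          mul_le_mul_of_nonneg_right (hp m (mem_insert_self m s)) htotal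
      _ ≤ ∑ i ∈ insert m s, P i * c i := by
          rw [sum_insert hms, sum_insert hms, mul_add]
          gcongr

/-- Telescoping of `1 - ∏ x` along the order that an injective ranking `σ` induces on `s`. -/
theorem sum_one_sub_mul_prod_filter_lt {ι κ : Type*} [LinearOrder κ] (s : Finset ι)
    (x : ι → ℝ) (σ : ι → κ) (hσ : Function.Injective σ) :
    ∑ i ∈ s, (1 - x i) * ∏ j ∈ s with σ j < σ i, x j = 1 - ∏ i ∈ s, x i := by
  let _ : LinearOrder ι := LinearOrder.lift' σ hσ
  have h := prod_one_sub_ordered s (fun i => 1 - x i)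
  simp only [sub_sub_cancel] at h
  rw [h, sub_sub_cancel]
  refine sum_congr rfl fun i _ => ?_
  congr 1

/-- The revenue as a combination of the priority weights. -/
theorem revenue_eq_sum_priority_mul (n : ℕ) (a d W : Fin n → ℝ) (α t0 : ℝ)
    (hd : ∀ i, 0 < d i) (hα : 0 < α) (hα1 : α < 1) (σ : Equiv.Perm (Fin n)) :
    revenue n a d W α t0 σ = α ^ t0 * ∑ i, α ^ (d i - a i) * W i / (1 - α ^ d i) *
      ((1 - α ^ d i) * ∏ j with σ j < σ i, α ^ d j) := by
  rw [revenue, mul_sum]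
  refine sum_congr rfl fun i _ => ?_
  have hne : 1 - α ^ d i ≠ 0 := (sub_pos.2 (Real.rpow_lt_one hα.le hα1 (hd i))).ne'
  have hsum : ∑ j with σ j ≤ σ i, d j = d i + ∑ j with σ j < σ i, d j := by
    have hfilter : univ.filter (fun j => σ j ≤ σ i) =
        insert i (univ.filter fun j => σ j < σ i) := by
      ext j
      simp [le_iff_eq_or_lt]
    rw [hfilter, sum_insert (by simp)]
  have hexp : completionTime n d t0 σ i - a i =
      t0 + (d i - a i) + ∑ j with σ j < σ i, d j := by
    rw [completionTime, hsum]
    ring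
  rw [hexp, Real.rpow_add hα, Real.rpow_add hα, Real.rpow_sum_of_pos hα]
  field_simp

/-- If the priority weights `P_i = α^(d_i − a_i)·W_i/(1 − α^(d_i))` are non-increasing
in the index, then processing the tasks in index order maximizes total revenue. -/
theorem index_order_maximizes_revenue (n : ℕ) (a d W : Fin n → ℝ) (α t0 : ℝ)
    (hd : ∀ i, 0 < d i) (hW : ∀ i, 0 < W i) (hα : 0 < α) (hα1 : α < 1)
    (hP : ∀ i j : Fin n, i ≤ j →
      α ^ (d j - a j) * W j / (1 - α ^ (d j)) ≤ α ^ (d i - a i) * W i / (1 - α ^ (d i))) :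
    ∀ σ : Equiv.Perm (Fin n),
      revenue n a d W α t0 σ ≤ revenue n a d W α t0 (Equiv.refl (Fin n)) := by
  intro σ
  have hx0 : ∀ i, 0 < α ^ d i := fun i => Real.rpow_pos_of_pos hα _
  have hx1 : ∀ i, α ^ d i < 1 := fun i => Real.rpow_lt_one hα.le hα1 (hd i)
  rw [revenue_eq_sum_priority_mul n a d W α t0 hd hα hα1,
    revenue_eq_sum_priority_mul n a d W α t0 hd hα hα1]
  refine mul_le_mul_of_nonneg_left ?_ (Real.rpow_pos_of_pos hα _).le
  rw [← sub_nonneg, ← sum_sub_distrib]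
  simp only [← mul_sub]
  refine (zero_mul _).symm.le.trans (mul_sum_le_sum_mul_of_antitoneOn univ _ _
    (fun i _ j _ hij => hP i j hij) (fun k _ => ?_) 0 (fun i _ => ?_))
  · simp only [mul_sub, sum_sub_distrib, sub_nonneg]
    calc ∑ i with i ≤ k, (1 - α ^ d i) * ∏ j with σ j < σ i, α ^ d j
        ≤ ∑ i with i ≤ k, (1 - α ^ d i) *
            ∏ j ∈ univ.filter (fun j => j ≤ k) with σ j < σ i, α ^ d j := by
          refine sum_le_sum fun i _ => mul_le_mul_of_nonneg_left ?_ (sub_nonneg.2 (hx1 i).le)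
          exact prod_le_prod_of_subset_of_le_one (filter_subset_filter _ (filter_subset _ _))
            (fun j _ => (hx0 j).le) (fun j _ _ => (hx1 j).le)
      _ = 1 - ∏ i with i ≤ k, α ^ d i := sum_one_sub_mul_prod_filter_lt _ _ σ σ.injective
      _ = ∑ i with i ≤ k, (1 - α ^ d i) *
            ∏ j ∈ univ.filter (fun j => j ≤ k) with j < i, α ^ d j :=
          (sum_one_sub_mul_prod_filter_lt _ _ id Function.injective_id).symm
      _ = ∑ i with i ≤ k, (1 - α ^ d i) *
            ∏ j with j < i, α ^ d j := by
          refine sum_congr rfl fun i hi => ?_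
          rw [filter_filter, filter_congr fun j _ =>
            and_iff_right_of_imp fun hji : j < i => hji.le.trans (mem_filter.1 hi).2]
  · exact div_nonneg (mul_nonneg (Real.rpow_pos_of_pos hα _).le (hW i).le)
      (sub_nonneg.2 (hx1 i).le)
end

section
/- Consider two tasks j and k to be processed consecutively starting at time t0. Processing j before k yields revenue at least that of processing k before j, i.e., W_j·α^(t0 + d_j − a_j) + W_k·α^(t0 + d_j + d_k − a_k) ≥ W_k·α^(t0 + d_k − a_k) + W_j·α^(t0 + d_k + d_j − a_j), if and only if α^(d_j − a_j)·W_j/(1 − α^(d_j)) ≥ α^(d_k − a_k)·W_k/(1 − α^(d_k)). -/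
/-- Processing task `j` before task `k` (consecutively, starting at `t0`) yields revenue
at least that of processing `k` before `j` iff
`α^(d_j − a_j)·W_j/(1 − α^(d_j)) ≥ α^(d_k − a_k)·W_k/(1 − α^(d_k))`. -/
theorem exchange_argument_iff (aj ak dj dk Wj Wk t0 α : ℝ)
    (hdj : 0 < dj) (hdk : 0 < dk) (hWj : 0 < Wj) (hWk : 0 < Wk)
    (hα : 0 < α) (hα1 : α < 1) :
    (Wk * α ^ (t0 + dk - ak) + Wj * α ^ (t0 + dk + dj - aj) ≤
      Wj * α ^ (t0 + dj - aj) + Wk * α ^ (t0 + dj + dk - ak)) ↔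
    α ^ (dk - ak) * Wk / (1 - α ^ dk) ≤ α ^ (dj - aj) * Wj / (1 - α ^ dj) := by
  have hj : 0 < 1 - α ^ dj := sub_pos.2 (Real.rpow_lt_one hα.le hα1 hdj)
  have hk : 0 < 1 - α ^ dk := sub_pos.2 (Real.rpow_lt_one hα.le hα1 hdk)
  have h₁ : α ^ (t0 + dk - ak) = α ^ t0 * α ^ (dk - ak) := by
    rw [← Real.rpow_add hα]; ring_nf
  have h₂ : α ^ (t0 + dk + dj - aj) = α ^ t0 * α ^ (dj - aj) * α ^ dk := by
    rw [← Real.rpow_add hα, ← Real.rpow_add hα]; ring_nf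
  have h₃ : α ^ (t0 + dj - aj) = α ^ t0 * α ^ (dj - aj) := by
    rw [← Real.rpow_add hα]; ring_nf
  have h₄ : α ^ (t0 + dj + dk - ak) = α ^ t0 * α ^ (dk - ak) * α ^ dj := by
    rw [← Real.rpow_add hα, ← Real.rpow_add hα]; ring_nf
  rw [div_le_div_iff₀ hk hj, h₁, h₂, h₃, h₄]
  conv_rhs => rw [← mul_le_mul_iff_right₀ (Real.rpow_pos_of_pos hα t0)]
  constructor <;> intro h <;> linarith
end

section
/- Consider two tasks j and k with linear valuations processed consecutively starting at time t0. Processing j before k yields total revenue at least that of processing k before j, i.e., [w_j − β_j·(t0 + d_j − a_j)] + [w_k − β_k·(t0 + d_j + d_k − a_k)] ≥ [w_k − β_k·(t0 + d_k − a_k)] + [w_j − β_j·(t0 + d_k + d_j − a_j)], if and only if β_j/d_j ≥ β_k/d_k. -/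
/-- With linear valuations, processing task `j` before task `k` (consecutively, starting
at `t0`) yields total revenue at least that of processing `k` before `j` iff
`β_j/d_j ≥ β_k/d_k`. -/
theorem linear_exchange_argument_iff (aj ak dj dk wj wk bj bk t0 : ℝ)
    (hdj : 0 < dj) (hdk : 0 < dk) (hbj : 0 < bj) (hbk : 0 < bk) :
    ((wk - bk * (t0 + dk - ak)) + (wj - bj * (t0 + dk + dj - aj)) ≤
      (wj - bj * (t0 + dj - aj)) + (wk - bk * (t0 + dj + dk - ak))) ↔
    bk / dk ≤ bj / dj := by
  rw [div_le_div_iff₀ hdk hdj]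
  constructor <;> intro h <;> linarith
end

section
/- Under the linear valuation, suppose the tasks are indexed so that β_0/d_0 ≥ β_1/d_1 ≥ ... ≥ β_{n-1}/d_{n-1}. Then processing the tasks in index order maximizes the total linear revenue over all schedules: for every permutation σ of {0,...,n-1}, V'(id) ≥ V'(σ), where id is the identity permutation. -/
open Finset

/-- Total linear revenue of schedule `σ`: `V'(σ) = ∑_i (w_i − β_i·(C_i(σ) − a_i))`. -/
noncomputable def linearRevenue (n : ℕ) (a d w β : Fin n → ℝ) (t0 : ℝ)
    (σ : Equiv.Perm (Fin n)) : ℝ :=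
  ∑ i, (w i - β i * (completionTime n d t0 σ i - a i))

/-- The revenue of a schedule is the schedule-independent part minus the weighted sum, over all
pairs, of the processing times of the tasks scheduled no later than a given one. -/
theorem linearRevenue_eq_sub_sum (n : ℕ) (a d w β : Fin n → ℝ) (t0 : ℝ)
    (σ : Equiv.Perm (Fin n)) :
    linearRevenue n a d w β t0 σ =
      ∑ i, (w i - β i * (t0 - a i)) - ∑ i, ∑ j, if σ j ≤ σ i then β i * d j else 0 := by
  rw [linearRevenue, ← Finset.sum_sub_distrib]
  refine Finset.sum_congr rfl fun i _ => ?_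
  rw [completionTime, ← Finset.sum_filter, ← Finset.mul_sum]
  ring

/-- A double sum can be bounded by comparing its symmetrized terms. -/
theorem sum_sum_le_sum_sum_of_add_swap_le {ι : Type*} [Fintype ι] {f g : ι → ι → ℝ}
    (h : ∀ i j, f i j + f j i ≤ g i j + g j i) : ∑ i, ∑ j, f i j ≤ ∑ i, ∑ j, g i j := by
  have key := Finset.sum_le_sum fun i (_ : i ∈ Finset.univ) =>
    Finset.sum_le_sum fun j (_ : j ∈ Finset.univ) => h i j
  simp only [Finset.sum_add_distrib] at key
  rw [Finset.sum_comm (f := fun i j => f j i), Finset.sum_comm (f := fun i j => g j i)] at key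
  linarith

/-- If `β_i/d_i` is non-increasing in the index, then processing the tasks in index
order maximizes the total linear revenue over all schedules. -/
theorem index_order_maximizes_linear_revenue (n : ℕ) (a d w β : Fin n → ℝ) (t0 : ℝ)
    (hd : ∀ i, 0 < d i) (hβ : ∀ i, 0 < β i)
    (hP : ∀ i j : Fin n, i ≤ j → β j / d j ≤ β i / d i) :
    ∀ σ : Equiv.Perm (Fin n),
      linearRevenue n a d w β t0 σ ≤ linearRevenue n a d w β t0 (Equiv.refl (Fin n)) := by
  intro σ
  have cross : ∀ i j : Fin n, i ≤ j → β j * d i ≤ β i * d j := fun i j hij =>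
    (div_le_div_iff₀ (hd j) (hd i)).1 (hP i j hij)
  rw [linearRevenue_eq_sub_sum, linearRevenue_eq_sub_sum]
  refine sub_le_sub_left (sum_sum_le_sum_sum_of_add_swap_le fun i j => ?_) _
  simp only [Equiv.refl_apply]
  rcases lt_trichotomy i j with hij | rfl | hij
  · have := cross i j hij.le
    rcases lt_or_gt_of_ne (σ.injective.ne hij.ne) with h | h <;>
      simp [hij.le, hij.not_ge, h.le, h.not_ge, this]
  · simp
  · have := cross j i hij.le
    rcases lt_or_gt_of_ne (σ.injective.ne hij.ne) with h | h <;>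
      simp [hij.le, hij.not_ge, h.le, h.not_ge, this]
end
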